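/- Let 𝒜 be a bicomplete abelian category with a complete hereditary cotorsion triple (𝒳, 𝒵, 𝒴). Then the following three classes of morphisms form a Quillen model structure on 𝒜 (the injective model structure): cofibrations are all monomorphisms; fibrations are the epimorphisms with kernel in 𝒴; weak equivalences are the morphisms f that factor as f = p ∘ i with i a monomorphism whose cokernel lies in 𝒵 and p an epimorphism whose kernel is injective. In this model structure every object is cofibrant, the fibrant objects are exactly the objects of 𝒴, and an object M is trivial (i.e., 0 → M is a weak equivalence) exactly when M ∈ 𝒵. -/

import Mathlib

open CategoryTheory Abelian Limits ZeroObject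

universe v u

variable {A : Type u} [Category.{v} A] [Abelian A]
  [EnoughProjectives A] [EnoughInjectives A]

noncomputable instance : HasExt.{max u v} A :=
  have := HasDerivedCategory.standard A
  hasExt_of_hasDerivedCategory A

/-- Vanishing of the `n`-th Ext group. -/
def extZero (M N : A) (n : ℕ) : Prop := Subsingleton (Abelian.Ext M N n)

/-- `(X, Z)` is a cotorsion pair: `X` consists exactly of the objects `M` with
`Ext¹(M, Z') = 0` for all `Z' ∈ Z`, and `Z` consists exactly of the objects `M`
with `Ext¹(X', M) = 0` for all `X' ∈ X`. -/
def IsCotorsionPair (X Z : Set A) : Prop :=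
  (∀ M : A, M ∈ X ↔ ∀ Z' ∈ Z, extZero M Z' 1) ∧
  (∀ M : A, M ∈ Z ↔ ∀ X' ∈ X, extZero X' M 1)

/-- A cotorsion pair is hereditary if `Ext^i(X', Z') = 0` for all `X' ∈ X`,
`Z' ∈ Z` and all `i ≥ 1`. -/
def IsHereditaryCotorsionPair (X Z : Set A) : Prop :=
  IsCotorsionPair X Z ∧ ∀ X' ∈ X, ∀ Z' ∈ Z, ∀ i : ℕ, 1 ≤ i → extZero X' Z' i

/-- A cotorsion pair is complete if every object `M` admits short exact sequences
`0 → Z' → X' → M → 0` and `0 → M → Z'' → X'' → 0` with `X', X'' ∈ X` and `Z', Z'' ∈ Z`. -/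
def IsCompleteCotorsionPair (X Z : Set A) : Prop :=
  IsCotorsionPair X Z ∧
    ∀ M : A,
      (∃ (Z' X' : A) (f : Z' ⟶ X') (g : X' ⟶ M) (w : f ≫ g = 0),
        (ShortComplex.mk f g w).ShortExact ∧ X' ∈ X ∧ Z' ∈ Z) ∧
      (∃ (Z'' X'' : A) (f : M ⟶ Z'') (g : Z'' ⟶ X'') (w : f ≫ g = 0),
        (ShortComplex.mk f g w).ShortExact ∧ X'' ∈ X ∧ Z'' ∈ Z)

/-- `(X, Z, Y)` is a cotorsion triple if `(X, Z)` and `(Z, Y)` are cotorsion pairs. -/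
def IsCotorsionTriple (X Z Y : Set A) : Prop :=
  IsCotorsionPair X Z ∧ IsCotorsionPair Z Y

/-- A cotorsion triple is hereditary if both constituent cotorsion pairs are hereditary. -/
def IsHereditaryCotorsionTriple (X Z Y : Set A) : Prop :=
  IsHereditaryCotorsionPair X Z ∧ IsHereditaryCotorsionPair Z Y

/-- A cotorsion triple is complete and hereditary if both constituent cotorsion pairs
are complete and hereditary. -/
def IsCompleteHereditaryCotorsionTriple (X Z Y : Set A) : Prop :=
  IsCompleteCotorsionPair X Z ∧ IsCompleteCotorsionPair Z Y ∧
    IsHereditaryCotorsionPair X Z ∧ IsHereditaryCotorsionPair Z Y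

/-- `f` is a retract of `g` (in the arrow category). -/
def IsRetract {X₁ Y₁ X₂ Y₂ : A} (f : X₁ ⟶ Y₁) (g : X₂ ⟶ Y₂) : Prop :=
  ∃ (i : Arrow.mk f ⟶ Arrow.mk g) (r : Arrow.mk g ⟶ Arrow.mk f),
    i ≫ r = 𝟙 (Arrow.mk f)

/-- The classes `W` (weak equivalences), `Cof` (cofibrations) and `Fib` (fibrations)
form a Quillen model structure: two-out-of-three for `W`, closure of all three
classes under retracts, the lifting axioms, and the factorization axioms. -/
structure IsModelStructure (W Cof Fib : MorphismProperty A) : Prop where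
  weq_comp : ∀ {X Y Z : A} (f : X ⟶ Y) (g : Y ⟶ Z), W f → W g → W (f ≫ g)
  weq_of_comp_left : ∀ {X Y Z : A} (f : X ⟶ Y) (g : Y ⟶ Z), W (f ≫ g) → W g → W f
  weq_of_comp_right : ∀ {X Y Z : A} (f : X ⟶ Y) (g : Y ⟶ Z), W (f ≫ g) → W f → W g
  weq_retract : ∀ {X₁ Y₁ X₂ Y₂ : A} (f : X₁ ⟶ Y₁) (g : X₂ ⟶ Y₂),
    IsRetract f g → W g → W f
  cof_retract : ∀ {X₁ Y₁ X₂ Y₂ : A} (f : X₁ ⟶ Y₁) (g : X₂ ⟶ Y₂),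
    IsRetract f g → Cof g → Cof f
  fib_retract : ∀ {X₁ Y₁ X₂ Y₂ : A} (f : X₁ ⟶ Y₁) (g : X₂ ⟶ Y₂),
    IsRetract f g → Fib g → Fib f
  lift_trivCof_fib : ∀ {X₁ Y₁ X₂ Y₂ : A} (i : X₁ ⟶ Y₁) (p : X₂ ⟶ Y₂),
    Cof i → W i → Fib p → HasLiftingProperty i p
  lift_cof_trivFib : ∀ {X₁ Y₁ X₂ Y₂ : A} (i : X₁ ⟶ Y₁) (p : X₂ ⟶ Y₂),
    Cof i → Fib p → W p → HasLiftingProperty i p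
  factor_trivCof_fib : ∀ {X Y : A} (f : X ⟶ Y),
    ∃ (Z : A) (i : X ⟶ Z) (p : Z ⟶ Y), Cof i ∧ W i ∧ Fib p ∧ i ≫ p = f
  factor_cof_trivFib : ∀ {X Y : A} (f : X ⟶ Y),
    ∃ (Z : A) (i : X ⟶ Z) (p : Z ⟶ Y), Cof i ∧ Fib p ∧ W p ∧ i ≫ p = f

/-- The weak equivalences of the injective model structure: morphisms factoring as
a monomorphism with cokernel in `𝒵` followed by an epimorphism with injective kernel. -/
def injW (Zs : Set A) : MorphismProperty A := fun X Y f =>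
  ∃ (M : A) (i : X ⟶ M) (p : M ⟶ Y),
    i ≫ p = f ∧ Mono i ∧ cokernel i ∈ Zs ∧ Epi p ∧ Injective (kernel p)

/-- The cofibrations of the injective model structure: all monomorphisms. -/
def injCof : MorphismProperty A := fun _ _ f => Mono f

/-- The fibrations of the injective model structure: epimorphisms with kernel in `𝒴`. -/
def injFib (Ys : Set A) : MorphismProperty A := fun _ _ f =>
  Epi f ∧ kernel f ∈ Ys

set_option linter.unusedSectionVars false

lemma ses_comp_epi {X Y Z : A} (f : X ⟶ Y) (g : Y ⟶ Z) [Mono (f ≫ g)] [Epi g] :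
    ∃ (a : kernel g ⟶ cokernel f) (b : cokernel f ⟶ cokernel (f ≫ g)) (w : a ≫ b = 0),
      (ShortComplex.mk a b w).ShortExact := by
  have hex := kernelCokernelCompSequence_exact f g
  refine ⟨kernelCokernelCompSequence.δ f g,
    cokernel.map f (f ≫ g) (𝟙 _) g (by simp), hex.toIsComplex.zero 2, ?_⟩
  refine ShortComplex.ShortExact.mk' (hex.exact 2) ?_ ?_
  · exact (hex.exact 1).mono_g ((isZero_kernel_of_mono (f ≫ g)).eq_of_src _ _)
  · exact (hex.exact 3).epi_f ((isZero_cokernel_of_epi g).eq_of_tgt _ _)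

lemma ses_comp_mono {X Y Z : A} (f : X ⟶ Y) (g : Y ⟶ Z) [Mono g] :
    ∃ (a : cokernel f ⟶ cokernel (f ≫ g)) (b : cokernel (f ≫ g) ⟶ cokernel g) (w : a ≫ b = 0),
      (ShortComplex.mk a b w).ShortExact := by
  have hex := kernelCokernelCompSequence_exact f g
  refine ⟨cokernel.map f (f ≫ g) (𝟙 _) g (by simp),
    cokernel.map (f ≫ g) g f (𝟙 _) (by simp), hex.toIsComplex.zero 3, ?_⟩
  refine ShortComplex.ShortExact.mk' (hex.exact 3) ?_ ?_
  · exact (hex.exact 2).mono_g ((isZero_kernel_of_mono g).eq_of_src _ _)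
  · dsimp; infer_instance

lemma ses_comp_ker {X Y Z : A} (f : X ⟶ Y) (g : Y ⟶ Z) [Mono f] [Epi (f ≫ g)] :
    ∃ (a : kernel (f ≫ g) ⟶ kernel g) (b : kernel g ⟶ cokernel f) (w : a ≫ b = 0),
      (ShortComplex.mk a b w).ShortExact := by
  have hex := kernelCokernelCompSequence_exact f g
  refine ⟨kernel.map (f ≫ g) g f (𝟙 _) (by simp),
    kernelCokernelCompSequence.δ f g, hex.toIsComplex.zero 1, ?_⟩
  refine ShortComplex.ShortExact.mk' (hex.exact 1) ?_ ?_
  · exact (hex.exact 0).mono_g ((isZero_kernel_of_mono f).eq_of_src _ _)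
  · exact (hex.exact 2).epi_f ((isZero_cokernel_of_epi (f ≫ g)).eq_of_tgt _ _)

lemma ses_comp_ker' {X Y Z : A} (f : X ⟶ Y) (g : Y ⟶ Z) [Epi f] :
    ∃ (a : kernel f ⟶ kernel (f ≫ g)) (b : kernel (f ≫ g) ⟶ kernel g) (w : a ≫ b = 0),
      (ShortComplex.mk a b w).ShortExact := by
  have hex := kernelCokernelCompSequence_exact f g
  refine ⟨kernel.map f (f ≫ g) (𝟙 _) g (by simp),
    kernel.map (f ≫ g) g f (𝟙 _) (by simp), hex.toIsComplex.zero 0, ?_⟩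
  refine ShortComplex.ShortExact.mk' (hex.exact 0) ?_ ?_
  · dsimp; infer_instance
  · exact (hex.exact 1).epi_f ((isZero_cokernel_of_epi f).eq_of_tgt _ _)

lemma ext_mid {S : ShortComplex A} (hS : S.ShortExact) (X : A)
    (h1 : extZero X S.X₁ 1) (h3 : extZero X S.X₃ 1) : extZero X S.X₂ 1 := by
  unfold extZero at *
  refine subsingleton_of_forall_eq 0 fun x => ?_
  obtain ⟨y, rfl⟩ := Ext.covariant_sequence_exact₂ X hS x (Subsingleton.elim _ _)
  rw [Subsingleton.elim y 0, Ext.zero_comp]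

lemma ext_right {S : ShortComplex A} (hS : S.ShortExact) (X : A)
    (h1 : extZero X S.X₁ 2) (h2 : extZero X S.X₂ 1) : extZero X S.X₃ 1 := by
  unfold extZero at *
  refine subsingleton_of_forall_eq 0 fun x => ?_
  obtain ⟨y, rfl⟩ := Ext.covariant_sequence_exact₃ X hS x (n₁ := 2) rfl (Subsingleton.elim _ _)
  rw [Subsingleton.elim y 0, Ext.zero_comp]

lemma ext_left {S : ShortComplex A} (hS : S.ShortExact) (Y : A)
    (h2 : extZero S.X₂ Y 1) (h3 : extZero S.X₃ Y 2) : extZero S.X₁ Y 1 := by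
  unfold extZero at *
  refine subsingleton_of_forall_eq 0 fun x => ?_
  obtain ⟨y, rfl⟩ := Ext.contravariant_sequence_exact₁ hS Y x (n₁ := 2) rfl (Subsingleton.elim _ _)
  rw [Subsingleton.elim y 0, Ext.comp_zero]

lemma ext_retract (X : A) {M N : A} (r : Retract M N) (h : extZero X N 1) : extZero X M 1 := by
  unfold extZero at *
  refine subsingleton_of_forall_eq 0 fun x => ?_
  have : x = (x.comp (Ext.mk₀ r.i) (add_zero 1)).comp (Ext.mk₀ r.r) (add_zero 1) := by
    rw [Ext.comp_assoc_of_third_deg_zero, Ext.mk₀_comp_mk₀, r.retract, Ext.comp_mk₀_id]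
  rw [this, Subsingleton.elim (x.comp (Ext.mk₀ r.i) (add_zero 1)) 0, Ext.zero_comp]

lemma lift_of_ext {X₁ Y₁ X₂ Y₂ : A} (i : X₁ ⟶ Y₁) (p : X₂ ⟶ Y₂) [Mono i] [Epi p]
    (h : extZero (cokernel i) (kernel p) 1) : HasLiftingProperty i p := by
  unfold extZero at h
  have hi : (ShortComplex.mk i (cokernel.π i) (cokernel.condition i)).ShortExact :=
    { exact := ShortComplex.exact_cokernel i }
  have hp : (ShortComplex.mk (kernel.ι p) p (kernel.condition p)).ShortExact :=
    { exact := ShortComplex.exact_kernel p }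
  refine ⟨fun {t b} sq => ?_⟩
  have h0 : (Ext.mk₀ b).comp hp.extClass (zero_add 1) = 0 := by
    obtain ⟨y, hy⟩ := Ext.contravariant_sequence_exact₂ hi _
      ((Ext.mk₀ b).comp hp.extClass (zero_add 1)) (by
        dsimp
        rw [Ext.mk₀_comp_mk₀_assoc, ← sq.w, ← Ext.mk₀_comp_mk₀_assoc]
        have := hp.comp_extClass
        dsimp at this
        rw [this, Ext.comp_zero])
    rw [← hy]
    have : y = 0 := Subsingleton.elim (α := Ext (cokernel i) (kernel p) 1) y 0
    rw [this, Ext.comp_zero]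
  obtain ⟨s, hs⟩ := Ext.covariant_sequence_exact₃ _ hp (Ext.mk₀ b) (zero_add 1) h0
  obtain ⟨s, rfl⟩ := (Ext.mk₀_bijective _ _).2 s
  rw [Ext.mk₀_comp_mk₀] at hs
  replace hs := (Ext.mk₀_bijective _ _).1 hs
  dsimp at s hs
  obtain ⟨d, hd⟩ := Ext.contravariant_sequence_exact₁ hi (kernel p)
    (Ext.mk₀ (kernel.lift p (t - i ≫ s) (by simp [hs, sq.w]))) (n₁ := 1) rfl
    (Subsingleton.elim (α := Ext (cokernel i) (kernel p) 1) _ _)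
  obtain ⟨d, rfl⟩ := (Ext.mk₀_bijective _ _).2 d
  rw [Ext.mk₀_comp_mk₀] at hd
  replace hd := (Ext.mk₀_bijective _ _).1 hd
  dsimp at d hd
  refine ⟨⟨⟨s + d ≫ kernel.ι p, ?_, ?_⟩⟩⟩
  · rw [Preadditive.comp_add, reassoc_of% hd]; simp
  · simp [hs]

/-- The closure properties of the class of trivial objects which are used below. -/
structure IsThickClass (Zs : Set A) : Prop where
  mid : ∀ {S : ShortComplex A}, S.ShortExact → S.X₁ ∈ Zs → S.X₃ ∈ Zs → S.X₂ ∈ Zs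
  right : ∀ {S : ShortComplex A}, S.ShortExact → S.X₁ ∈ Zs → S.X₂ ∈ Zs → S.X₃ ∈ Zs
  left : ∀ {S : ShortComplex A}, S.ShortExact → S.X₂ ∈ Zs → S.X₃ ∈ Zs → S.X₁ ∈ Zs
  retract : ∀ {M N : A}, Retract M N → N ∈ Zs → M ∈ Zs
  inj : ∀ {I : A}, Injective I → I ∈ Zs

lemma retract_right {Ps Qs : Set A} (h : IsCotorsionPair Ps Qs) {M N : A} (r : Retract M N)
    (hN : N ∈ Qs) : M ∈ Qs :=
  (h.2 M).2 fun X hX => ext_retract X r ((h.2 N).1 hN X hX)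

lemma inj_right {Ps Qs : Set A} (h : IsCotorsionPair Ps Qs) {I : A} (hI : Injective I) : I ∈ Qs :=
  (h.2 I).2 fun X _ => Ext.subsingleton_of_injective X I 0

lemma mid_right {Ps Qs : Set A} (h : IsCotorsionPair Ps Qs) {S : ShortComplex A}
    (hS : S.ShortExact) (h1 : S.X₁ ∈ Qs) (h3 : S.X₃ ∈ Qs) : S.X₂ ∈ Qs :=
  (h.2 _).2 fun X hX => ext_mid hS X ((h.2 _).1 h1 X hX) ((h.2 _).1 h3 X hX)

lemma isThickClass_of_triple {Xs Zs Ys : Set A}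
    (h : IsCompleteHereditaryCotorsionTriple Xs Zs Ys) : IsThickClass Zs where
  mid hS h1 h3 := mid_right h.1.1 hS h1 h3
  right hS h1 h2 := (h.1.1.2 _).2 fun X hX =>
    ext_right hS X (h.2.2.1.2 X hX _ h1 2 (by norm_num)) ((h.1.1.2 _).1 h2 X hX)
  left hS h2 h3 := (h.2.1.1.1 _).2 fun Y hY =>
    ext_left hS Y ((h.2.1.1.1 _).1 h2 Y hY) (h.2.2.2.2 _ h3 Y hY 2 (by norm_num))
  retract r hN := retract_right h.1.1 r hN
  inj hI := inj_right h.1.1 hI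

lemma injective_of_mem {Zs Ys : Set A} (hZ : IsThickClass Zs) (h : IsCotorsionPair Zs Ys) {M : A}
    (hMZ : M ∈ Zs) (hMY : M ∈ Ys) : Injective M := by
  let i := Injective.ι M
  have hi : (ShortComplex.mk i (cokernel.π i) (cokernel.condition i)).ShortExact :=
    { exact := ShortComplex.exact_cokernel i }
  have hC : cokernel i ∈ Zs := hZ.right hi hMZ (hZ.inj (Injective.injective_under M))
  have hE : extZero (cokernel i) M 1 := (h.2 M).1 hMY _ hC
  unfold extZero at hE
  obtain ⟨d, hd⟩ := Ext.contravariant_sequence_exact₁ hi M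
    (Ext.mk₀ (𝟙 M)) (n₁ := 1) rfl
    (Subsingleton.elim (α := Ext (cokernel i) M 1) _ _)
  obtain ⟨d, rfl⟩ := (Ext.mk₀_bijective _ _).2 d
  rw [Ext.mk₀_comp_mk₀] at hd
  replace hd := (Ext.mk₀_bijective _ _).1 hd
  dsimp at d hd
  have r : Retract M (Injective.under M) := ⟨i, d, hd⟩
  exact r.injective

lemma cokernel_mem_of_pullback {Zs : Set A} (hZ : IsThickClass Zs) {X M N Y : A}
    (i : X ⟶ M) (p : M ⟶ Y) (j : X ⟶ N) (q : N ⟶ Y) (w : i ≫ p = j ≫ q) [Mono i] [Mono j]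
    (hp : epiWithInjectiveKernel p) (hq : epiWithInjectiveKernel q) (hi : cokernel i ∈ Zs) :
    cokernel j ∈ Zs := by
  have := hp.1
  have := hq.1
  have sq := IsPullback.of_hasPullback p q
  have e1 := isIso_kernel_map_of_isPullback sq
  have e2 := isIso_kernel_map_of_isPullback sq.flip
  have k1 : kernel (pullback.fst p q) ∈ Zs :=
    hZ.retract (asIso (kernel.map _ _ _ _ sq.w)).retract (hZ.inj hq.2)
  have k2 : kernel (pullback.snd p q) ∈ Zs :=
    hZ.retract (asIso (kernel.map _ _ _ _ sq.flip.w)).retract (hZ.inj hp.2)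
  let l := pullback.lift i j w
  have h1 : l ≫ pullback.fst p q = i := pullback.lift_fst ..
  have h2 : l ≫ pullback.snd p q = j := pullback.lift_snd ..
  have hl : cokernel l ∈ Zs := by
    have : Mono (l ≫ pullback.fst p q) := by rw [h1]; infer_instance
    obtain ⟨a, b, w, hS⟩ := ses_comp_epi l (pullback.fst p q)
    exact hZ.mid hS k1 (by dsimp; rw [h1]; exact hi)
  have : Mono (l ≫ pullback.snd p q) := by rw [h2]; infer_instance
  obtain ⟨a, b, w, hS⟩ := ses_comp_epi l (pullback.snd p q)
  rw [← h2]
  exact hZ.right hS k2 hl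

lemma injW_iff {Zs : Set A} (hZ : IsThickClass Zs) {X N Y : A} {f : X ⟶ Y}
    (j : X ⟶ N) (q : N ⟶ Y) (w : j ≫ q = f) [Mono j]
    (hq : epiWithInjectiveKernel q) : injW Zs f ↔ cokernel j ∈ Zs := by
  constructor
  · rintro ⟨M, i, p, w', hi, hi', hp, hp'⟩
    exact cokernel_mem_of_pullback hZ i p j q (w'.trans w.symm) ⟨hp, hp'⟩ hq hi'
  · intro h
    exact ⟨N, j, q, w, inferInstance, h, hq.1, hq.2⟩

lemma eik_fst (Y I : A) [Injective I] : epiWithInjectiveKernel (biprod.fst : Y ⊞ I ⟶ Y) := by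
  rw [epiWithInjectiveKernel_iff]
  exact ⟨I, inferInstance, biprod.inr, by simp,
    ⟨{ r := biprod.snd, s := biprod.inl, id := by simp [add_comm] }⟩⟩

lemma injW_of_mono_iff {Zs : Set A} (hZ : IsThickClass Zs) {X Y : A} (f : X ⟶ Y) [Mono f] :
    injW Zs f ↔ cokernel f ∈ Zs :=
  injW_iff hZ f (𝟙 Y) (by simp) (epiWithInjectiveKernel_of_iso _)

lemma injW_of_eik {Zs : Set A} (hZ : IsThickClass Zs) {X Y : A} (f : X ⟶ Y)
    (hf : epiWithInjectiveKernel f) : injW Zs f := by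
  rw [injW_iff hZ (𝟙 X) f (by simp) hf]
  exact hZ.inj ((isZero_cokernel_of_epi (𝟙 X)).injective)

lemma eik_of_injW {Zs Ys : Set A} (hZ : IsThickClass Zs) (h : IsCotorsionPair Zs Ys) {X Y : A}
    (f : X ⟶ Y) (hf : injFib Ys f) (hW : injW Zs f) : epiWithInjectiveKernel f := by
  obtain ⟨hf, hY⟩ := hf
  refine ⟨hf, injective_of_mem hZ h ?_ hY⟩
  obtain ⟨M, i, p, rfl, hi, hi', hp, hp'⟩ := hW
  obtain ⟨a, b, w, hS⟩ := ses_comp_ker i p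
  exact hZ.left hS (hZ.inj hp') hi'

/-- The cokernel does not change when adding an identity. -/
noncomputable def cokerBiprodIso {Y N : A} (j : Y ⟶ N) (I : A) :
    cokernel (biprod.map j (𝟙 I)) ≅ cokernel j where
  hom := cokernel.map _ _ biprod.fst biprod.fst (by simp)
  inv := cokernel.map _ _ biprod.inl biprod.inl (by simp)
  hom_inv_id := by
    ext
    · simp
    · have : (biprod.inr : I ⟶ N ⊞ I) ≫ cokernel.π (biprod.map j (𝟙 I)) = 0 := by
        have := (biprod.inr : I ⟶ Y ⊞ I) ≫= cokernel.condition (biprod.map j (𝟙 I))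
        rwa [← Category.assoc, biprod.inr_map, Category.id_comp, comp_zero] at this
      simp [this]
  inv_hom_id := by ext; simp

lemma two_of_three {Zs : Set A} (hZ : IsThickClass Zs) {X Y Z : A} (f : X ⟶ Y) (g : Y ⟶ Z) :
    ∃ S : ShortComplex A, S.ShortExact ∧ (injW Zs f ↔ S.X₁ ∈ Zs) ∧ (injW Zs g ↔ S.X₃ ∈ Zs) ∧
      (injW Zs (f ≫ g) ↔ S.X₂ ∈ Zs) := by
  let I := Injective.under X
  let J := Injective.under Y
  let j : X ⟶ Y ⊞ I := biprod.lift f (Injective.ι X)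
  let j' : Y ⟶ Z ⊞ J := biprod.lift g (Injective.ι Y)
  have hj : Mono j := mono_of_mono_fac (biprod.lift_snd f (Injective.ι X))
  have hj' : Mono j' := mono_of_mono_fac (biprod.lift_snd g (Injective.ι Y))
  let k : Y ⊞ I ⟶ (Z ⊞ J) ⊞ I := biprod.map j' (𝟙 I)
  have hk : Mono k := inferInstanceAs (Mono (biprod.map j' (𝟙 I)))
  obtain ⟨a, b, w, hS⟩ := ses_comp_mono j k
  refine ⟨_, hS, injW_iff hZ j biprod.fst (by simp [j]) (eik_fst _ _), ?_,
    injW_iff hZ (j ≫ k) (biprod.fst ≫ biprod.fst) (by simp [j, k, j'])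
      (MorphismProperty.comp_mem _ _ _ (eik_fst _ _) (eik_fst _ _))⟩
  rw [injW_iff hZ j' biprod.fst (by simp [j']) (eik_fst _ _)]
  exact ⟨hZ.retract (cokerBiprodIso j' I).retract, hZ.retract (cokerBiprodIso j' I).symm.retract⟩

lemma injW_retract {Zs : Set A} (hZ : IsThickClass Zs) {X₁ Y₁ X₂ Y₂ : A} (f : X₁ ⟶ Y₁)
    (g : X₂ ⟶ Y₂) (iX : X₁ ⟶ X₂) (iY : Y₁ ⟶ Y₂) (rX : X₂ ⟶ X₁) (rY : Y₂ ⟶ Y₁)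
    (hi : iX ≫ g = f ≫ iY) (hr : rX ≫ f = g ≫ rY) (hX : iX ≫ rX = 𝟙 _) (hY : iY ≫ rY = 𝟙 _)
    (hg : injW Zs g) : injW Zs f := by
  let I := Injective.under X₁
  let J := Injective.under X₂
  let e := Injective.ι X₁
  let e' := Injective.ι X₂
  let α : I ⟶ J := Injective.factorThru (iX ≫ e') e
  have hα : e ≫ α = iX ≫ e' := Injective.comp_factorThru _ _
  let j : X₁ ⟶ Y₁ ⊞ I := biprod.lift f e
  let j' : X₂ ⟶ Y₂ ⊞ (I ⊞ J) := biprod.lift g (biprod.lift (rX ≫ e) e')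
  have hj : Mono j := mono_of_mono_fac (biprod.lift_snd f e)
  have hj' : Mono j' := by
    have : j' ≫ biprod.snd ≫ biprod.snd = e' := by simp [j']
    exact mono_of_mono_fac this
  rw [injW_iff hZ j' biprod.fst (by simp [j']) (eik_fst _ _)] at hg
  rw [injW_iff hZ j biprod.fst (by simp [j]) (eik_fst _ _)]
  refine hZ.retract ⟨cokernel.map j j' iX (biprod.map iY (biprod.lift (𝟙 I) α)) ?_,
    cokernel.map j' j rX (biprod.map rY biprod.fst) ?_, ?_⟩ hg
  · ext
    · simp [j, j', hi]
    · simp [j, j', reassoc_of% hX]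
    · simp [j, j', hα]
  · ext <;> simp [j, j', hr]
  · apply coequalizer.hom_ext
    simp only [cokernel.map, cokernel.π_desc_assoc, Category.assoc, cokernel.π_desc,
      Category.comp_id]
    rw [← Category.assoc]
    convert Category.id_comp _
    ext <;> simp [hY]

lemma factor_triv {Zs Ys : Set A} (hZ : IsThickClass Zs) (h : IsCompleteCotorsionPair Zs Ys)
    {X Y : A} (f : X ⟶ Y) :
    ∃ (Z : A) (i : X ⟶ Z) (p : Z ⟶ Y), Mono i ∧ injW Zs i ∧ injFib Ys p ∧ i ≫ p = f := by
  let I := Injective.under X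
  let j : X ⟶ Y ⊞ I := biprod.lift f (Injective.ι X)
  have hj : Mono j := mono_of_mono_fac (biprod.lift_snd f (Injective.ι X))
  obtain ⟨Y', Z', u, v, w, hS, hZ', hY'⟩ := (h.2 (cokernel j)).1
  have hv : Epi v := hS.epi_g
  let P := pullback (cokernel.π j) v
  let i : X ⟶ P := pullback.lift j 0 (by simp)
  have h1 : i ≫ pullback.fst _ _ = j := pullback.lift_fst ..
  have h2 : i ≫ pullback.snd _ _ = 0 := pullback.lift_snd ..
  have hi : Mono i := mono_of_mono_fac h1
  have hSE : (ShortComplex.mk i (pullback.snd _ _) h2).ShortExact := by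
    refine ShortComplex.ShortExact.mk' (ShortComplex.exact_of_f_is_kernel _ ?_) hi ?_
    · refine KernelFork.IsLimit.ofι' _ _ (fun {T} k hk => ?_)
      have hk' : (k ≫ pullback.fst _ _) ≫ cokernel.π j = 0 := by
        rw [Category.assoc, pullback.condition, reassoc_of% hk, zero_comp]
      have hex := (ShortComplex.exact_cokernel j)
      refine ⟨hex.lift _ hk', ?_⟩
      apply pullback.hom_ext
      · rw [Category.assoc]
        refine Eq.trans ?_ (hex.lift_f _ hk')
        exact congrArg _ h1
      · rw [Category.assoc]
        exact (congrArg _ h2).trans (comp_zero.trans hk.symm)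
    · exact Abelian.epi_pullback_of_epi_f _ _
  have hci : cokernel i ∈ Zs := hZ.retract
    (IsColimit.coconePointUniqueUpToIso (cokernelIsCokernel i) hSE.gIsCokernel).retract hZ'
  have sq := IsPullback.of_hasPullback (cokernel.π j) v
  have e1 := isIso_kernel_map_of_isPullback sq
  have k1 : kernel (pullback.fst (cokernel.π j) v) ∈ Ys := by
    refine retract_right h.1 (asIso (kernel.map _ _ _ _ sq.w)).retract ?_
    exact retract_right h.1
      (IsLimit.conePointUniqueUpToIso (kernelIsKernel v) hS.fIsKernel).retract hY'
  have hq := eik_fst Y I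
  have := hq.1
  refine ⟨P, i, pullback.fst _ _ ≫ biprod.fst, hi, (injW_of_mono_iff hZ i).2 hci,
    ⟨inferInstance, ?_⟩, ?_⟩
  · obtain ⟨a, b, w, hS⟩ := ses_comp_ker' (pullback.fst (cokernel.π j) v)
      (biprod.fst : Y ⊞ I ⟶ Y)
    exact mid_right h.1 hS k1 (inj_right h.1 hq.2)
  · rw [reassoc_of% h1]; simp [j]

/-- Let `𝒜` be a bicomplete abelian category with a complete hereditary cotorsion
triple `(𝒳, 𝒵, 𝒴)`. Then the injective classes form a Quillen model structure
on `𝒜`, in which every object is cofibrant, the fibrant objects are exactly the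
objects of `𝒴`, and `M` is trivial exactly when `M ∈ 𝒵`. -/
theorem injective_model_structure [HasLimits A] [HasColimits A]
    (Xs Zs Ys : Set A) (h : IsCompleteHereditaryCotorsionTriple Xs Zs Ys) :
    IsModelStructure (injW Zs) injCof (injFib Ys) ∧
    (∀ M : A, injCof (0 : (0 : A) ⟶ M)) ∧
    (∀ M : A, injFib Ys (0 : M ⟶ (0 : A)) ↔ M ∈ Ys) ∧
    (∀ M : A, injW Zs (0 : (0 : A) ⟶ M) ↔ M ∈ Zs) := by
  have hZ := isThickClass_of_triple h
  have hY := h.2.1.1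
  refine ⟨?_, fun M => ?_, fun M => ?_, fun M => ?_⟩
  · constructor
    · intro X Y Z f g hf hg
      obtain ⟨S, hS, h1, h3, h2⟩ := two_of_three hZ f g
      exact h2.2 (hZ.mid hS (h1.1 hf) (h3.1 hg))
    · intro X Y Z f g hf hg
      obtain ⟨S, hS, h1, h3, h2⟩ := two_of_three hZ f g
      exact h1.2 (hZ.left hS (h2.1 hf) (h3.1 hg))
    · intro X Y Z f g hf hg
      obtain ⟨S, hS, h1, h3, h2⟩ := two_of_three hZ f g
      exact h3.2 (hZ.right hS (h1.1 hg) (h2.1 hf))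
    · rintro X₁ Y₁ X₂ Y₂ f g ⟨i, r, hir⟩ hg
      let R : RetractArrow f g := ⟨i, r, hir⟩
      exact injW_retract hZ f g _ _ _ _ R.i_w R.r_w R.retract_left R.retract_right hg
    · rintro X₁ Y₁ X₂ Y₂ f g ⟨i, r, hir⟩ hg
      let R : RetractArrow f g := ⟨i, r, hir⟩
      exact (MorphismProperty.monomorphisms A).of_retract R hg
    · rintro X₁ Y₁ X₂ Y₂ f g ⟨i, r, hir⟩ hg
      let R : RetractArrow f g := ⟨i, r, hir⟩
      refine ⟨(MorphismProperty.epimorphisms A).of_retract R hg.1, ?_⟩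
      refine retract_right hY (N := kernel g)
        ⟨kernel.map f g R.i.left R.i.right R.i_w.symm,
          kernel.map g f R.r.left R.r.right R.r_w.symm, ?_⟩ hg.2
      apply equalizer.hom_ext
      simp only [kernel.map, Category.assoc, kernel.lift_ι, kernel.lift_ι_assoc, Category.id_comp]
      exact (congrArg _ R.retract_left).trans (Category.comp_id _)
    · intro X₁ Y₁ X₂ Y₂ i p hi hW hp
      have : Mono i := hi
      have := hp.1
      exact lift_of_ext i p ((hY.2 _).1 hp.2 _ ((injW_of_mono_iff hZ i).1 hW))
    · intro X₁ Y₁ X₂ Y₂ i p hi hp hW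
      have : Mono i := hi
      exact (eik_of_injW hZ hY p hp hW).hasLiftingProperty i
    · intro X Y f
      exact factor_triv hZ h.2.1 f
    · intro X Y f
      have hq := eik_fst Y (Injective.under X)
      exact ⟨_, biprod.lift f (Injective.ι X), biprod.fst,
        mono_of_mono_fac (biprod.lift_snd f (Injective.ι X)),
        ⟨hq.1, inj_right hY hq.2⟩, injW_of_eik hZ _ hq, by simp⟩
  · exact inferInstanceAs (Mono (0 : (0 : A) ⟶ M))
  · have : Epi (0 : M ⟶ (0 : A)) := inferInstance
    exact ⟨fun hM => retract_right hY kernelZeroIsoSource.symm.retract hM.2,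
      fun hM => ⟨this, retract_right hY kernelZeroIsoSource.retract hM⟩⟩
  · rw [injW_of_mono_iff hZ]
    exact ⟨hZ.retract cokernelZeroIsoTarget.symm.retract,
      hZ.retract cokernelZeroIsoTarget.retract⟩
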